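/- (Convergence of IPG to a critical point.) Let h : ℝ^N → ℝ be convex, let g : ℝ^N → ℝ be differentiable (possibly non-convex) with L-Lipschitz continuous gradient, let 0 < γ < 1/L, and suppose f = g + h is bounded below. Let (x_k) satisfy x_k ∈ Prox^{ε_k}_{γh}(x_{k−1} − γ∇g(x_{k−1})) for all k ≥ 1, where the errors ε_k ≥ 0 form a nonincreasing sequence with Σ_{k=1}^∞ ε_k < ∞. Then Σ_{k=1}^∞ ‖x_k − x_{k−1}‖² < ∞ (so ‖x_k − x_{k−1}‖ → 0), and there exist vectors d_k ∈ ∂_{ε_k} h(x_k) such that ‖∇g(x_k) + d_k‖ → 0 as k → ∞. -/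

import Mathlib

open scoped RealInnerProductSpace
open Filter Topology

noncomputable section

abbrev E (N : ℕ) := EuclideanSpace ℝ (Fin N)

/-- `z` is an `ε`-inexact proximal point of `h` with stepsize `γ` at `y`:
`(1/(2γ))‖z − y‖² + h(z) ≤ ε + (1/(2γ))‖x − y‖² + h(x)` for all `x`. -/
def IsInexactProx {N : ℕ} (γ : ℝ) (h : E N → ℝ) (ε : ℝ) (y z : E N) : Prop :=
  ∀ x : E N, 1 / (2 * γ) * ‖z - y‖ ^ 2 + h z ≤ ε + 1 / (2 * γ) * ‖x - y‖ ^ 2 + h x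

/-- The `ε`-approximate subdifferential of `h` at `x`. -/
def epsSubdiff {N : ℕ} (h : E N → ℝ) (ε : ℝ) (x : E N) : Set (E N) :=
  {d : E N | ∀ y : E N, h y ≥ h x + ⟪d, y - x⟫ - ε}


/-- The descent lemma for functions with Lipschitz gradient. -/
theorem le_add_inner_add_of_lipschitz_gradient {F : Type*} [NormedAddCommGroup F]
    [InnerProductSpace ℝ F] [CompleteSpace F] {g : F → ℝ} {g' : F → F} {L : ℝ}
    (hg : ∀ x, HasGradientAt g (g' x) x)
    (hlip : ∀ x y, ‖g' x - g' y‖ ≤ L * ‖x - y‖) (x y : F) :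
    g y ≤ g x + ⟪g' x, y - x⟫ + L / 2 * ‖y - x‖ ^ 2 := by
  set s := y - x with hs
  have hderiv : ∀ t : ℝ, HasDerivAt
      (fun t : ℝ => g (x + t • s) - t * ⟪g' x, s⟫ - L / 2 * ‖s‖ ^ 2 * t ^ 2)
      (⟪g' (x + t • s), s⟫ - ⟪g' x, s⟫ - L * t * ‖s‖ ^ 2) t := by
    intro t
    have hline : HasDerivAt (fun t : ℝ => x + t • s) s t := by
      simpa using ((hasDerivAt_id t).smul_const s).const_add x
    have hcomp : HasDerivAt (fun t : ℝ => g (x + t • s)) ⟪g' (x + t • s), s⟫ t := by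
      simpa [Function.comp_def] using! (hg (x + t • s)).hasFDerivAt.comp_hasDerivAt t hline
    have hlin : HasDerivAt (fun t : ℝ => t * ⟪g' x, s⟫) ⟪g' x, s⟫ t := by
      simpa using (hasDerivAt_id t).mul_const ⟪g' x, s⟫
    have hquad := (hasDerivAt_pow 2 t).const_mul (L / 2 * ‖s‖ ^ 2)
    refine ((hcomp.sub hlin).sub hquad).congr_deriv ?_
    simp
    ring
  have hanti := antitoneOn_of_hasDerivWithinAt_nonpos (convex_Icc (0 : ℝ) 1)
    (fun t _ => (hderiv t).continuousAt.continuousWithinAt)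
    (fun t _ => (hderiv t).hasDerivWithinAt) (by
      intro t ht
      rw [interior_Icc] at ht
      have hinner := real_inner_le_norm (g' (x + t • s) - g' x) s
      have hgrad := hlip (x + t • s) x
      rw [add_sub_cancel_left, norm_smul, Real.norm_of_nonneg ht.1.le] at hgrad
      rw [inner_sub_left] at hinner
      nlinarith [mul_le_mul_of_nonneg_right hgrad (norm_nonneg s)])
  have h01 := hanti (Set.left_mem_Icc.2 zero_le_one) (Set.right_mem_Icc.2 zero_le_one)
    zero_le_one
  have hy : x + s = y := by simp [hs]
  simp only [one_smul, zero_smul, add_zero, hy] at h01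
  linarith

/-- A point whose value does not exceed that of an inexact proximal point is close to it. -/
theorem IsInexactProx.norm_sub_sq_le {N : ℕ} {γ ε : ℝ} {h : E N → ℝ} {y z : E N}
    (hz : IsInexactProx γ h ε y z) (hconv : ConvexOn ℝ Set.univ h) (hγ : 0 < γ) {a : E N}
    (ha : 1 / (2 * γ) * ‖a - y‖ ^ 2 + h a ≤ 1 / (2 * γ) * ‖z - y‖ ^ 2 + h z) :
    ‖a - z‖ ^ 2 ≤ 8 * γ * ε := by
  have hmid := hz ((1 / 2 : ℝ) • a + (1 / 2 : ℝ) • z)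
  have hh := hconv.2 (Set.mem_univ a) (Set.mem_univ z) (by norm_num : (0 : ℝ) ≤ 1 / 2)
    (by norm_num : (0 : ℝ) ≤ 1 / 2) (by norm_num)
  have hpar : ‖(1 / 2 : ℝ) • a + (1 / 2 : ℝ) • z - y‖ ^ 2 =
      1 / 2 * ‖a - y‖ ^ 2 + 1 / 2 * ‖z - y‖ ^ 2 - 1 / 4 * ‖a - z‖ ^ 2 := by
    have h1 : (1 / 2 : ℝ) • a + (1 / 2 : ℝ) • z - y = (1 / 2 : ℝ) • ((a - y) + (z - y)) := by
      module
    have h2 : a - z = (a - y) - (z - y) := by abel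
    rw [h1, h2, norm_smul, mul_pow, norm_add_sq_real, norm_sub_sq_real (a - y)]
    norm_num
    ring
  rw [hpar] at hmid
  simp only [smul_eq_mul] at hh
  have hkey : 1 / (2 * γ) * (1 / 4 * ‖a - z‖ ^ 2) ≤ ε := by nlinarith
  have hscale : ‖a - z‖ ^ 2 = 8 * γ * (1 / (2 * γ) * (1 / 4 * ‖a - z‖ ^ 2)) := by
    field_simp
    ring
  rw [hscale]
  exact mul_le_mul_of_nonneg_left hkey (by positivity)

/-- If `h` has an inexact proximal point at `y`, it has an exact one. -/
theorem IsInexactProx.exists_exact {N : ℕ} {γ ε : ℝ} {h : E N → ℝ} {y z : E N}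
    (hz : IsInexactProx γ h ε y z) (hconv : ConvexOn ℝ Set.univ h) (hγ : 0 < γ) :
    ∃ p, IsInexactProx γ h 0 y p := by
  have hcont : Continuous h := continuousOn_univ.1 (hconv.continuousOn isOpen_univ)
  obtain ⟨p, -, hp⟩ := (isCompact_closedBall z √(8 * γ * ε)).exists_isMinOn
    ⟨z, Metric.mem_closedBall_self (Real.sqrt_nonneg _)⟩
    (f := fun a => 1 / (2 * γ) * ‖a - y‖ ^ 2 + h a) (by fun_prop)
  refine ⟨p, fun a => ?_⟩
  rw [zero_add]
  by_cases ha : a ∈ Metric.closedBall z √(8 * γ * ε)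
  · exact hp ha
  · refine (hp (Metric.mem_closedBall_self (Real.sqrt_nonneg _))).trans ?_
    by_contra! hlt
    exact ha (mem_closedBall_iff_norm.2
      (Real.le_sqrt_of_sq_le (hz.norm_sub_sq_le hconv hγ hlt.le)))

/-- The variational inequality characterizing exact proximal points. -/
theorem IsInexactProx.add_inner_le {N : ℕ} {γ : ℝ} {h : E N → ℝ} {y p : E N}
    (hp : IsInexactProx γ h 0 y p) (hconv : ConvexOn ℝ Set.univ h) (hγ : 0 < γ) (w : E N) :
    h p + ⟪γ⁻¹ • (y - p), w - p⟫ ≤ h w := by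
  set A := h w - h p - ⟪γ⁻¹ • (y - p), w - p⟫ with hA
  set B := 1 / (2 * γ) * ‖w - p‖ ^ 2 with hB
  have hB0 : 0 ≤ B := by positivity
  have hstep : ∀ t : ℝ, 0 < t → t ≤ 1 → 0 ≤ A + t * B := by
    intro t ht0 ht1
    have hmin := hp ((1 - t) • p + t • w)
    have hh := hconv.2 (Set.mem_univ p) (Set.mem_univ w) (sub_nonneg.2 ht1) ht0.le
      (sub_add_cancel 1 t)
    have hpt : (1 - t) • p + t • w - y = t • (w - p) - (y - p) := by module
    have hpy : ‖p - y‖ = ‖y - p‖ := norm_sub_rev p y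
    rw [hpt, norm_sub_sq_real (t • (w - p)), norm_smul, mul_pow, Real.norm_of_nonneg ht0.le,
      real_inner_smul_left, hpy] at hmin
    simp only [smul_eq_mul] at hh
    have hexp : t * (A + t * B) = (1 - t) * h p + t * h w - h p
        + 1 / (2 * γ) * (t ^ 2 * ‖w - p‖ ^ 2 - 2 * (t * ⟪w - p, y - p⟫)) := by
      rw [hA, hB, real_inner_smul_left, real_inner_comm]
      field_simp
      ring
    refine nonneg_of_mul_nonneg_right ?_ ht0
    rw [hexp]
    linarith
  have hA0 : 0 ≤ A := by
    by_contra! hneg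
    have hpos : 0 < B - A := by linarith
    have ht := hstep (-A / (B - A)) (div_pos (neg_pos.2 hneg) hpos)
      ((div_le_one hpos).2 (by linarith))
    have heq : A + -A / (B - A) * B = -(A ^ 2) / (B - A) := by
      field_simp
      ring
    rw [heq] at ht
    have : -(A ^ 2) / (B - A) < 0 := div_neg_of_neg_of_pos (by nlinarith) hpos
    linarith
  linarith

/-- An `ε`-inexact proximal point `z` at `y` admits an `ε`-subgradient of the form
`γ⁻¹ • (y - p)` with `p` at distance at most `√(2γε)` from `z`. -/
theorem IsInexactProx.exists_mem_epsSubdiff {N : ℕ} {γ ε : ℝ} {h : E N → ℝ} {y z : E N}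
    (hz : IsInexactProx γ h ε y z) (hconv : ConvexOn ℝ Set.univ h) (hγ : 0 < γ) :
    ∃ p, γ⁻¹ • (y - p) ∈ epsSubdiff h ε z ∧ ‖z - p‖ ^ 2 ≤ 2 * γ * ε := by
  obtain ⟨p, hp⟩ := hz.exists_exact hconv hγ
  have hgap : h z + 1 / (2 * γ) * ‖z - p‖ ^ 2 ≤ ε + h p + ⟪γ⁻¹ • (y - p), z - p⟫ := by
    have hzp := hz p
    have hpy : ‖p - y‖ = ‖y - p‖ := norm_sub_rev p y
    have hzy : z - y = (z - p) - (y - p) := by abel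
    rw [hzy, norm_sub_sq_real (z - p), hpy] at hzp
    have hin : ⟪γ⁻¹ • (y - p), z - p⟫ = 1 / (2 * γ) * (2 * ⟪z - p, y - p⟫) := by
      rw [real_inner_smul_left, real_inner_comm]
      field_simp
    linarith
  have hnn : 0 ≤ 1 / (2 * γ) * ‖z - p‖ ^ 2 := by positivity
  refine ⟨p, fun w => ?_, ?_⟩
  · have hw := hp.add_inner_le hconv hγ w
    have hsplit : ⟪γ⁻¹ • (y - p), w - p⟫ =
        ⟪γ⁻¹ • (y - p), w - z⟫ + ⟪γ⁻¹ • (y - p), z - p⟫ := by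
      rw [← inner_add_right, sub_add_sub_cancel]
    linarith
  · have hvz := hp.add_inner_le hconv hγ z
    have hle : 1 / (2 * γ) * ‖z - p‖ ^ 2 ≤ ε := by linarith
    rwa [one_div, inv_mul_le_iff₀ (by positivity)] at hle

/-- Each inexact proximal gradient step decreases `g + h` up to the error `ε`. -/
theorem IsInexactProx.sufficient_decrease {N : ℕ} {g h : E N → ℝ} {g' : E N → E N}
    {L γ ε : ℝ} {x z : E N} (hg : ∀ x, HasGradientAt g (g' x) x)
    (hlip : ∀ x y, ‖g' x - g' y‖ ≤ L * ‖x - y‖) (hγ : 0 < γ)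
    (hz : IsInexactProx γ h ε (x - γ • g' x) z) :
    g z + h z + (1 / (2 * γ) - L / 2) * ‖z - x‖ ^ 2 ≤ g x + h x + ε := by
  have hdesc := le_add_inner_add_of_lipschitz_gradient hg hlip x z
  have hzx := hz x
  have h1 : z - (x - γ • g' x) = (z - x) + γ • g' x := by abel
  have h2 : x - (x - γ • g' x) = γ • g' x := by abel
  rw [h1, h2, norm_add_sq_real, real_inner_smul_right, real_inner_comm] at hzx
  have hin : ⟪g' x, z - x⟫ = 1 / (2 * γ) * (2 * (γ * ⟪g' x, z - x⟫)) := by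
    field_simp
  linarith

/-- A nonnegative sequence that is dominated by the decrease of a function bounded below, up to
a summable error, is summable. -/
theorem summable_of_add_le_add {F a ε : ℕ → ℝ} {m : ℝ} (hF : ∀ k, m ≤ F k)
    (ha : ∀ k, 0 ≤ a k) (hε : ∀ k, 0 ≤ ε k) (hεsum : Summable ε)
    (hdec : ∀ k, F (k + 1) + a k ≤ F k + ε k) : Summable a := by
  refine summable_of_sum_range_le (c := F 0 - m + ∑' k, ε k) ha fun n => ?_
  have hpart : F n + ∑ k ∈ Finset.range n, a k ≤ F 0 + ∑ k ∈ Finset.range n, ε k := by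
    induction n with
    | zero => simp
    | succ n ih =>
      rw [Finset.sum_range_succ, Finset.sum_range_succ]
      linarith [hdec n]
  linarith [hF n, hεsum.sum_le_tsum (Finset.range n) fun k _ => hε k]

/-- convergence of IPG to a critical point. -/
theorem ipg_converges_to_critical_point {N : ℕ} (g h : E N → ℝ) (g' : E N → E N)
    (L γ : ℝ) (hL : 0 < L)
    (hg : ∀ x, HasGradientAt g (g' x) x)
    (hlip : ∀ x y, ‖g' x - g' y‖ ≤ L * ‖x - y‖)
    (hconv : ConvexOn ℝ Set.univ h)
    (hγ0 : 0 < γ) (hγL : γ < 1 / L)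
    (hbdd : BddBelow (Set.range fun y => g y + h y))
    (x : ℕ → E N) (ε : ℕ → ℝ)
    (hε : ∀ k, 0 ≤ ε k) (hεmono : ∀ k, ε (k + 1) ≤ ε k) (hεsum : Summable ε)
    (hstep : ∀ k, IsInexactProx γ h (ε k) (x k - γ • g' (x k)) (x (k + 1))) :
    Summable (fun k => ‖x (k + 1) - x k‖ ^ 2) ∧
      Tendsto (fun k => ‖x (k + 1) - x k‖) atTop (𝓝 0) ∧
      ∃ d : ℕ → E N, (∀ k, d k ∈ epsSubdiff h (ε k) (x (k + 1))) ∧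
        Tendsto (fun k => ‖g' (x (k + 1)) + d k‖) atTop (𝓝 0) := by
  have hc : 0 < 1 / (2 * γ) - L / 2 := by
    have hγL' : γ * L < 1 := (lt_div_iff₀ hL).1 hγL
    have heq : 1 / (2 * γ) - L / 2 = (1 - γ * L) / (2 * γ) := by
      field_simp
    rw [heq]
    exact div_pos (by linarith) (by linarith)
  obtain ⟨m, hm⟩ := hbdd
  have hsum : Summable (fun k => ‖x (k + 1) - x k‖ ^ 2) := by
    rw [← summable_mul_left_iff hc.ne']
    exact summable_of_add_le_add (F := fun k => g (x k) + h (x k))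
      (fun k => hm ⟨x k, rfl⟩) (fun k => by positivity) hε hεsum
      fun k => (hstep k).sufficient_decrease hg hlip hγ0
  have hlim : Tendsto (fun k => ‖x (k + 1) - x k‖) atTop (𝓝 0) := by
    simpa [Real.sqrt_sq] using hsum.tendsto_atTop_zero.sqrt
  choose p hp hdist using fun k => (hstep k).exists_mem_epsSubdiff hconv hγ0
  refine ⟨hsum, hlim, fun k => γ⁻¹ • (x k - γ • g' (x k) - p k), hp, ?_⟩
  have hplim : Tendsto (fun k => √(2 * γ * ε k)) atTop (𝓝 0) := by
    simpa using (hεsum.tendsto_atTop_zero.const_mul (2 * γ)).sqrt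
  have hbound : Tendsto (fun k => (L + γ⁻¹) * ‖x (k + 1) - x k‖ + γ⁻¹ * √(2 * γ * ε k))
      atTop (𝓝 0) := by
    simpa using (hlim.const_mul (L + γ⁻¹)).add (hplim.const_mul γ⁻¹)
  refine squeeze_zero (fun k => norm_nonneg _) (fun k => ?_) hbound
  have hγi : γ⁻¹ • γ • g' (x k) = g' (x k) := inv_smul_smul₀ hγ0.ne' _
  have hdecomp : g' (x (k + 1)) + γ⁻¹ • (x k - γ • g' (x k) - p k) =
      (g' (x (k + 1)) - g' (x k)) - γ⁻¹ • (x (k + 1) - x k) + γ⁻¹ • (x (k + 1) - p k) := by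
    simp only [smul_sub, hγi]
    abel
  have hsmul : ∀ v : E N, ‖γ⁻¹ • v‖ = γ⁻¹ * ‖v‖ := fun v => by
    rw [norm_smul, Real.norm_of_nonneg (inv_nonneg.2 hγ0.le)]
  calc ‖g' (x (k + 1)) + γ⁻¹ • (x k - γ • g' (x k) - p k)‖
      ≤ ‖g' (x (k + 1)) - g' (x k)‖ + ‖γ⁻¹ • (x (k + 1) - x k)‖
          + ‖γ⁻¹ • (x (k + 1) - p k)‖ := by
        rw [hdecomp]
        exact (norm_add_le _ _).trans (add_le_add_left (norm_sub_le _ _) _)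
    _ ≤ L * ‖x (k + 1) - x k‖ + γ⁻¹ * ‖x (k + 1) - x k‖ + γ⁻¹ * √(2 * γ * ε k) := by
        rw [hsmul, hsmul]
        gcongr
        · exact hlip _ _
        · exact Real.le_sqrt_of_sq_le (hdist k)
    _ = (L + γ⁻¹) * ‖x (k + 1) - x k‖ + γ⁻¹ * √(2 * γ * ε k) := by ring
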